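/- arXiv:2403.09053 — 8 statements merged into one kernel-verified Lean document; each statement's English description precedes it below -/
import Mathlib

section
/- Let X be a finite input space with |X| = m ≥ 2, Y = {0,1}, and let F = G = Y^X be the class of all functions from X to Y. Then: (i) F is (ε=0, δ=0)-distillable into G using 0 samples (by the algorithm that outputs f itself); but (ii) for any 0 < ε ≤ 1/16, no learning algorithm using n ≤ (m−1)/(64ε) samples can (ε, 1/2)-learn F with hypothesis class G: for every A_learn : X^n × Y^n → G there exist a probability distribution D on X and a concept f ∈ F such that P_{S=(x_1,…,x_n)~D^n}[ error_{f,D}(A_learn(S,(f(x_1),…,f(x_n)))) ≥ ε ] ≥ 1/2. -/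
open MeasureTheory

/-- The error of `g` approximating `f` over distribution `D`: `P_{x ~ D}[g x ≠ f x]`. -/
noncomputable def err {X Y : Type*} [MeasurableSpace X] (D : Measure X) (f g : X → Y) :
    ENNReal :=
  D {x | g x ≠ f x}

section helpers

open Classical in
/-- Flip `f` on `V`. -/
noncomputable def flipOn {X : Type*} (V : Finset X) (f : X → Bool) : X → Bool :=
  fun x => if x ∈ V then !(f x) else f x

lemma flipOn_invol {X : Type*} (V : Finset X) : Function.Involutive (flipOn V) := by
  intro f
  funext x
  by_cases h : x ∈ V <;> simp [flipOn, h]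

lemma sum_flipOn {X : Type*} [Fintype X] [DecidableEq X] (V : Finset X) (b : (X → Bool) → ℕ) :
    ∑ f, b (flipOn V f) = ∑ f, b f :=
  Equiv.sum_comp (flipOn_invol V).toPerm b

open Classical in
lemma not_both_bad {X : Type*} (U V : Finset X) (hV : V ⊆ U) (k : ℕ)
    (hk : k ≤ 4 * V.card) (g f f' : X → Bool) (hd : ∀ x ∈ V, f x ≠ f' x)
    (h1 : 8 * (U.filter fun x => g x ≠ f x).card < k)
    (h2 : 8 * (U.filter fun x => g x ≠ f' x).card < k) : False := by
  have hsub : V ⊆ (U.filter fun x => g x ≠ f x) ∪ (U.filter fun x => g x ≠ f' x) := by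
    intro x hx
    have := hd x hx
    simp only [Finset.mem_union, Finset.mem_filter]
    by_cases h : g x = f x
    · right
      exact ⟨hV hx, by rw [h]; exact this⟩
    · left
      exact ⟨hV hx, h⟩
  have h3 := (Finset.card_le_card hsub).trans (Finset.card_union_le _ _)
  omega

lemma four_prop (p q r s : Prop) [Decidable p] [Decidable q] [Decidable r] [Decidable s]
    (a1 : p → q → False) (a2 : p → r → False) (a3 : p → s → False)
    (a4 : q → r → False) (a5 : q → s → False) (a6 : r → s → False) :
    (if p then 1 else 0) + (if q then 1 else 0) + (if r then 1 else 0) + (if s then 1 else 0)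
      ≤ 1 := by
  by_cases hp : p <;> by_cases hq : q <;> by_cases hr : r <;> by_cases hs : s <;> simp_all

open Classical in
lemma count_bad {X : Type*} [Fintype X] (U : Finset X) (k : ℕ) (hk2 : 2 ≤ k)
    (hu : 5 * k < 8 * U.card) (G : (X → Bool) → (X → Bool))
    (hG : ∀ f f' : X → Bool, (∀ x, x ∉ U → f x = f' x) → G f = G f') :
    4 * ∑ f : X → Bool, (if 8 * (U.filter fun x => G f x ≠ f x).card < k then 1 else 0)
      ≤ Fintype.card (X → Bool) := by
  obtain ⟨V, hVU, hVc⟩ := Finset.exists_subset_card_eq (show U.card / 2 ≤ U.card by omega)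
  have hVc' : (U \ V).card = U.card - U.card / 2 := by
    rw [Finset.card_sdiff_of_subset hVU, hVc]
  set W := U \ V with hW
  have hWU : W ⊆ U := Finset.sdiff_subset
  have hk1 : k ≤ 4 * V.card := by omega
  have hk3 : k ≤ 4 * W.card := by omega
  set bad : (X → Bool) → Prop := fun f => 8 * (U.filter fun x => G f x ≠ f x).card < k with hbad
  set b : (X → Bool) → ℕ := fun f => if bad f then 1 else 0 with hb
  have key : ∀ f f' : X → Bool, (∀ x, x ∉ U → f x = f' x) →
      ((∀ x ∈ V, f x ≠ f' x) ∨ (∀ x ∈ W, f x ≠ f' x)) → bad f → bad f' → False := by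
    intro f f' ha hd h1 h2
    simp only [hbad] at h1 h2
    rw [← hG f f' ha] at h2
    rcases hd with hd | hd
    · exact not_both_bad U V hVU k hk1 (G f) f f' hd h1 h2
    · exact not_both_bad U W hWU k hk3 (G f) f f' hd h1 h2
  have hdisj : ∀ x ∈ W, x ∉ V := fun x hx => (Finset.mem_sdiff.1 hx).2
  have hdisj' : ∀ x ∈ V, x ∉ W := fun x hx hx' => hdisj x hx' hx
  have four : ∀ f, b f + b (flipOn V f) + b (flipOn W f) + b (flipOn V (flipOn W f)) ≤ 1 := by
    intro f
    have o1 : ∀ x, x ∉ U → x ∉ V := fun x hx h => hx (hVU h)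
    have o2 : ∀ x, x ∉ U → x ∉ W := fun x hx h => hx (hWU h)
    have a1 := key f (flipOn V f) (fun x hx => by simp [flipOn, o1 x hx])
      (Or.inl fun x hx => by simp [flipOn, hx])
    have a2 := key f (flipOn W f) (fun x hx => by simp [flipOn, o2 x hx])
      (Or.inr fun x hx => by simp [flipOn, hx])
    have a3 := key f (flipOn V (flipOn W f)) (fun x hx => by simp [flipOn, o1 x hx, o2 x hx])
      (Or.inl fun x hx => by simp [flipOn, hx, hdisj' x hx])
    have a4 := key (flipOn V f) (flipOn W f) (fun x hx => by simp [flipOn, o1 x hx, o2 x hx])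
      (Or.inl fun x hx => by simp [flipOn, hx, hdisj' x hx])
    have a5 := key (flipOn V f) (flipOn V (flipOn W f))
      (fun x hx => by simp [flipOn, o1 x hx, o2 x hx])
      (Or.inr fun x hx => by simp [flipOn, hx, hdisj x hx])
    have a6 := key (flipOn W f) (flipOn V (flipOn W f))
      (fun x hx => by simp [flipOn, o1 x hx, o2 x hx])
      (Or.inl fun x hx => by simp [flipOn, hx, hdisj' x hx])
    simp only [hb]
    exact four_prop _ _ _ _ a1 a2 a3 a4 a5 a6
  have e1 := sum_flipOn V b
  have e2 := sum_flipOn W b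
  have e3 : ∑ f, b (flipOn V (flipOn W f)) = ∑ f, b f :=
    (sum_flipOn W (fun f => b (flipOn V f))).trans e1
  have := Finset.sum_le_sum (fun f (_ : f ∈ (Finset.univ : Finset (X → Bool))) => four f)
  rw [Finset.sum_add_distrib, Finset.sum_add_distrib, Finset.sum_add_distrib, e1, e2, e3] at this
  simp only [Finset.sum_const, Finset.card_univ, smul_eq_mul, mul_one] at this
  change 4 * ∑ f, b f ≤ _
  omega

open Classical in
/-- The hard distribution. -/
noncomputable def hardD {X : Type*} [Fintype X] [MeasurableSpace X] (x0 : X) (p q : ℝ) :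
    Measure X :=
  ENNReal.ofReal (1 - p) • Measure.dirac x0 +
    ENNReal.ofReal q • ∑ x ∈ Finset.univ.erase x0, Measure.dirac x

open Classical in
lemma hardD_finset {X : Type*} [Fintype X] [MeasurableSpace X] [MeasurableSingletonClass X]
    (x0 : X) (p q : ℝ) (T : Finset X) (hT : x0 ∉ T) :
    hardD x0 p q (T : Set X) = ENNReal.ofReal q * T.card := by
  have hm : MeasurableSet (T : Set X) := T.measurableSet
  simp only [hardD, Measure.add_apply, Measure.smul_apply, Measure.finsetSum_apply,
    Measure.dirac_apply' _ hm, smul_eq_mul]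
  have : (T : Set X).indicator (1 : X → ENNReal) x0 = 0 := by simp [hT]
  rw [this, mul_zero, zero_add]
  congr 1
  simp only [Set.indicator_apply, Finset.mem_coe, Pi.one_apply, Finset.sum_ite_mem,
    Finset.sum_const, nsmul_eq_mul, mul_one]
  congr 2
  ext x
  simp only [Finset.mem_inter, Finset.mem_erase, Finset.mem_univ, and_true]
  constructor
  · exact fun h => h.2
  · intro h
    exact ⟨fun e => hT (e ▸ h), h⟩

open Classical in
lemma hardD_x0 {X : Type*} [Fintype X] [MeasurableSpace X] [MeasurableSingletonClass X]
    (x0 : X) (p q : ℝ) : hardD x0 p q {x0} = ENNReal.ofReal (1 - p) := by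
  simp only [hardD, Measure.add_apply, Measure.smul_apply, Measure.finsetSum_apply,
    Measure.dirac_apply' _ (measurableSet_singleton x0), smul_eq_mul]
  rw [Finset.sum_eq_zero]
  · simp
  · intro x hx
    simp [Finset.ne_of_mem_erase hx]

open Classical in
lemma hardD_compl {X : Type*} [Fintype X] [MeasurableSpace X] [MeasurableSingletonClass X]
    (x0 : X) (p q : ℝ) (k : ℕ) (hk : Fintype.card X = k + 1) (hq : 0 ≤ q) (hpq : q * k = p) :
    hardD x0 p q {x | x ≠ x0} = ENNReal.ofReal p := by
  have : ({x | x ≠ x0} : Set X) = ((Finset.univ.erase x0 : Finset X) : Set X) := by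
    ext x; simp
  rw [this, hardD_finset _ _ _ _ (by simp), Finset.card_erase_of_mem (Finset.mem_univ _),
    Finset.card_univ, hk, ← hpq, ENNReal.ofReal_mul hq]
  simp

lemma hardD_prob {X : Type*} [Fintype X] [MeasurableSpace X] [MeasurableSingletonClass X]
    (x0 : X) (p q : ℝ) (k : ℕ) (hk : Fintype.card X = k + 1) (hq : 0 ≤ q) (hpq : q * k = p)
    (hp : p ≤ 1) : IsProbabilityMeasure (hardD x0 p q) := by
  constructor
  have h := measure_add_measure_compl (μ := hardD x0 p q) (measurableSet_singleton x0)
  have e : ({x0}ᶜ : Set X) = {x | x ≠ x0} := rfl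
  rw [← h, e, hardD_compl x0 p q k hk hq hpq, hardD_x0,
    ← ENNReal.ofReal_add (by linarith) (hpq ▸ by positivity)]
  simp

open Classical in
/-- Number of rare sample points. -/
noncomputable def hits {X : Type*} {n : ℕ} (x0 : X) (S : Fin n → X) : ℕ :=
  (Finset.univ.filter fun i => S i ≠ x0).card

open Classical in
/-- Unseen rare points. -/
noncomputable def unseen {X : Type*} [Fintype X] {n : ℕ} (x0 : X) (S : Fin n → X) : Finset X :=
  Finset.univ.filter fun x => x ≠ x0 ∧ ∀ i, S i ≠ x

open Classical in
lemma card_unseen {X : Type*} [Fintype X] {n : ℕ} (x0 : X) (S : Fin n → X) :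
    Fintype.card X ≤ (unseen x0 S).card + hits x0 S + 1 := by
  have hsub : (Finset.univ : Finset X) ⊆
      unseen x0 S ∪ ((Finset.univ.filter fun i => S i ≠ x0).image S) ∪ {x0} := by
    intro x _
    simp only [unseen, Finset.mem_union, Finset.mem_filter, Finset.mem_univ, true_and,
      Finset.mem_image, Finset.mem_singleton]
    by_cases h : x = x0
    · exact Or.inr h
    · left
      by_cases h' : ∀ i, S i ≠ x
      · exact Or.inl ⟨h, h'⟩
      · push Not at h'
        obtain ⟨i, hi⟩ := h'
        exact Or.inr ⟨i, hi ▸ h, hi⟩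
  have h1 := Finset.card_le_card hsub
  have h2 := Finset.card_union_le
    (unseen x0 S ∪ ((Finset.univ.filter fun i => S i ≠ x0).image S)) {x0}
  have h3 := Finset.card_union_le (unseen x0 S) ((Finset.univ.filter fun i => S i ≠ x0).image S)
  have h4 : ((Finset.univ.filter fun i => S i ≠ x0).image S).card ≤ hits x0 S :=
    Finset.card_image_le
  rw [Finset.card_univ] at h1
  rw [Finset.card_singleton] at h2
  omega

lemma all_meas {X : Type*} [Fintype X] [MeasurableSpace X] [MeasurableSingletonClass X]
    {n : ℕ} (s : Set (Fin n → X)) : MeasurableSet s := (Set.toFinite s).measurableSet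

open Classical in
lemma lintegral_hits {X : Type*} [Fintype X] [MeasurableSpace X] [MeasurableSingletonClass X]
    {n : ℕ} (x0 : X) (D : Measure X) [IsProbabilityMeasure D] :
    ∫⁻ S, (hits x0 S : ENNReal) ∂(Measure.pi fun _ : Fin n => D) = n * D {x | x ≠ x0} := by
  have : ∀ S : Fin n → X, (hits x0 S : ENNReal) =
      ∑ i, (Function.eval i ⁻¹' {x | x ≠ x0} : Set (Fin n → X)).indicator (fun _ => 1) S := by
    intro S
    simp [hits, Set.indicator_apply, Finset.sum_ite]
  simp_rw [this]
  rw [lintegral_finsetSum _ (fun i _ => measurable_const.indicator (all_meas _))]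
  have h : ∀ i : Fin n, ∫⁻ S, (Function.eval i ⁻¹' {x | x ≠ x0} : Set (Fin n → X)).indicator
      (fun _ => (1 : ENNReal)) S ∂(Measure.pi fun _ : Fin n => D) = D {x | x ≠ x0} := by
    intro i
    rw [lintegral_indicator_const (all_meas _), one_mul]
    exact (measurePreserving_eval (fun _ : Fin n => D) i).measure_preimage
      (Set.toFinite _).measurableSet.nullMeasurableSet
  rw [Finset.sum_congr rfl fun i _ => h i]
  simp only [Finset.sum_const, Finset.card_univ, Fintype.card_fin, nsmul_eq_mul]

lemma good_prob {X : Type*} [Fintype X] [MeasurableSpace X] [MeasurableSingletonClass X]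
    {n : ℕ} (x0 : X) (D : Measure X) [IsProbabilityMeasure D] (p : ℝ) (k : ℕ) (hk : 0 < k)
    (hD : D {x | x ≠ x0} = ENNReal.ofReal p) (hnp : n * p ≤ k / 8) :
    2 / 3 ≤ (Measure.pi fun _ : Fin n => D).real {S | 8 * hits x0 S < 3 * k} := by
  set μ := Measure.pi fun _ : Fin n => D
  have hM := mul_meas_ge_le_lintegral (μ := μ) (f := fun S => (hits x0 S : ENNReal))
    (measurable_of_finite _) (ENNReal.ofReal (3 * k / 8))
  rw [lintegral_hits, hD] at hM
  have hset : {S : Fin n → X | ENNReal.ofReal (3 * k / 8) ≤ (hits x0 S : ENNReal)} =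
      {S | 8 * hits x0 S < 3 * k}ᶜ := by
    ext S
    simp only [Set.mem_ofPred_eq, Set.mem_compl_iff, not_lt]
    rw [← ENNReal.ofReal_natCast, ENNReal.ofReal_le_ofReal_iff (by positivity),
      div_le_iff₀ (by norm_num)]
    constructor
    · intro h
      have : (3 * k : ℝ) ≤ 8 * hits x0 S := by linarith
      exact_mod_cast this
    · intro h
      have : (3 * k : ℝ) ≤ 8 * hits x0 S := by exact_mod_cast h
      linarith
  rw [hset, ← ENNReal.ofReal_natCast, ← ENNReal.ofReal_mul (by positivity),
    ← ofReal_measureReal, ← ENNReal.ofReal_mul (by positivity)] at hM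
  have hM2 := hM.trans (ENNReal.ofReal_le_ofReal hnp)
  rw [ENNReal.ofReal_le_ofReal_iff (by positivity)] at hM2
  rw [probReal_compl_eq_one_sub (all_meas _)] at hM2
  have hk' : (0 : ℝ) < k := by exact_mod_cast hk
  by_contra hc
  push Not at hc
  have : (k : ℝ) * (1 / 3) < k * (1 - μ.real {S | 8 * hits x0 S < 3 * k}) :=
    mul_lt_mul_of_pos_left (by linarith) hk'
  nlinarith

open Classical in
lemma err_ge {X : Type*} [Fintype X] [MeasurableSpace X] [MeasurableSingletonClass X]
    (x0 : X) (p q ε : ℝ) (k : ℕ) (hq : 0 ≤ q) (hqk : q * k = 8 * ε) (U : Finset X)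
    (hU : x0 ∉ U) (f g : X → Bool)
    (h : k ≤ 8 * (U.filter fun x => g x ≠ f x).card) :
    ENNReal.ofReal ε ≤ err (hardD x0 p q) f g := by
  have h1 : hardD x0 p q ((U.filter fun x => g x ≠ f x : Finset X) : Set X) ≤
      err (hardD x0 p q) f g := by
    apply measure_mono
    intro x hx
    simp only [Finset.coe_filter, Set.mem_ofPred_eq] at hx
    exact hx.2
  refine le_trans ?_ h1
  rw [hardD_finset _ _ _ _ (by simp [hU]), ← ENNReal.ofReal_natCast, ← ENNReal.ofReal_mul hq]
  apply ENNReal.ofReal_le_ofReal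
  have h' : (k : ℝ) ≤ 8 * (U.filter fun x => g x ≠ f x).card := by exact_mod_cast h
  have := mul_le_mul_of_nonneg_left h' hq
  linarith

open Classical in
lemma case_large {X : Type*} [Fintype X] [MeasurableSpace X] [MeasurableSingletonClass X]
    (x0 : X) (ε q : ℝ) (k n : ℕ) (hk2 : 2 ≤ k) (hk : Fintype.card X = k + 1) (hε : ε ≤ 1 / 16)
    (hq : 0 ≤ q) (hqk : q * k = 8 * ε) (hn : n * (8 * ε) ≤ k / 8)
    (A : (Fin n → X) → (Fin n → Bool) → (X → Bool)) :
    ∃ f : X → Bool, (Measure.pi fun _ : Fin n => hardD x0 (8 * ε) q)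
      {S | ENNReal.ofReal ε ≤ err (hardD x0 (8 * ε) q) f (A S fun i => f (S i))} ≥ 1 / 2 := by
  have hP : IsProbabilityMeasure (hardD x0 (8 * ε) q) :=
    hardD_prob x0 _ q k hk hq hqk (by linarith)
  set D := hardD x0 (8 * ε) q with hDdef
  have hgood := good_prob (n := n) x0 D (8 * ε) k (by omega) (hardD_compl x0 _ q k hk hq hqk) hn
  set μ := Measure.pi fun _ : Fin n => D
  set Good : Set (Fin n → X) := {S | 8 * hits x0 S < 3 * k}
  set B : (X → Bool) → Set (Fin n → X) := fun f =>
    {S | ENNReal.ofReal ε ≤ err D f (A S fun i => f (S i))} with hB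
  set N : ℕ := Fintype.card (X → Bool) with hN
  have hNpos : 0 < N := Fintype.card_pos
  -- pointwise bound
  have hpt : ∀ S, Good.indicator (fun _ => (3 / 4 * N : ℝ)) S ≤
      ∑ f, (B f).indicator (fun _ => (1 : ℝ)) S := by
    intro S
    by_cases hS : S ∈ Good
    · rw [Set.indicator_of_mem hS]
      have hS' : 8 * hits x0 S < 3 * k := hS
      have hc := card_unseen x0 S
      have hcount := count_bad (unseen x0 S) k hk2 (by omega) (fun f => A S fun i => f (S i))
        (by
          intro f f' hff
          have : (fun i => f (S i)) = fun i => f' (S i) := by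
            funext i
            apply hff
            simp only [unseen, Finset.mem_filter, Finset.mem_univ, true_and, not_and]
            intro _ h
            exact h i rfl
          simp only [this])
      have hcount' : 4 * ∑ f : X → Bool, (if 8 * ((unseen x0 S).filter
          fun x => A S (fun i => f (S i)) x ≠ f x).card < k then (1 : ℝ) else 0) ≤ N := by
        exact_mod_cast hcount
      have hge : ∀ f : X → Bool, 1 - (if 8 * ((unseen x0 S).filter
          fun x => A S (fun i => f (S i)) x ≠ f x).card < k then (1 : ℝ) else 0) ≤
          (B f).indicator (fun _ => (1 : ℝ)) S := by
        intro f
        split_ifs with h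
        · rw [sub_self]
          exact Set.indicator_nonneg (fun _ _ => zero_le_one) _
        · have : S ∈ B f := err_ge x0 _ q ε k hq hqk (unseen x0 S) (by simp [unseen]) _ _
            (not_lt.1 h)
          rw [Set.indicator_of_mem this]
          simp
      have hs := Finset.sum_le_sum (fun f (_ : f ∈ (Finset.univ : Finset (X → Bool))) => hge f)
      rw [Finset.sum_sub_distrib] at hs
      simp only [Finset.sum_const, Finset.card_univ, nsmul_eq_mul, mul_one] at hs
      rw [← hN] at hs
      linarith
    · rw [Set.indicator_of_notMem hS]
      exact Finset.sum_nonneg fun f _ => Set.indicator_nonneg (fun _ _ => zero_le_one) _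
  have hint : ∀ (s : Set (Fin n → X)) (c : ℝ), Integrable (s.indicator fun _ => c) μ :=
    fun s c => (integrable_const c).indicator (all_meas s)
  have hI := integral_mono (μ := μ) (hint _ _)
    (integrable_finsetSum Finset.univ (fun f _ => hint (B f) 1)) hpt
  rw [integral_finsetSum _ (fun f _ => hint (B f) 1)] at hI
  simp only [integral_indicator_const _ (all_meas _), smul_eq_mul, mul_one] at hI
  have hNR : (0 : ℝ) < N := by exact_mod_cast hNpos
  have hI2 : ∑ _f : X → Bool, (1 / 2 : ℝ) ≤ ∑ f, μ.real (B f) := by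
    refine le_trans ?_ hI
    simp only [Finset.sum_const, Finset.card_univ, nsmul_eq_mul]
    rw [← hN]
    nlinarith
  obtain ⟨f, _, hf⟩ := Finset.exists_le_of_sum_le Finset.univ_nonempty hI2
  refine ⟨f, ?_⟩
  have := ENNReal.ofReal_le_ofReal hf
  rw [ofReal_measureReal] at this
  refine le_trans (le_of_eq ?_) this
  rw [ENNReal.ofReal_div_of_pos (by norm_num)]
  simp

open Classical in
lemma case_two {X : Type*} [Fintype X] [MeasurableSpace X] [MeasurableSingletonClass X]
    (x0 x1 : X) (hx : x1 ≠ x0) (ε q : ℝ) (n : ℕ) (hk : Fintype.card X = 1 + 1)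
    (hε0 : 0 < ε) (hε : ε ≤ 1 / 16)
    (hq : 0 ≤ q) (hqk : q * (1 : ℕ) = 8 * ε) (hn : n * (8 * ε) ≤ (1 : ℕ) / 8)
    (A : (Fin n → X) → (Fin n → Bool) → (X → Bool)) :
    ∃ f : X → Bool, (Measure.pi fun _ : Fin n => hardD x0 (8 * ε) q)
      {S | ENNReal.ofReal ε ≤ err (hardD x0 (8 * ε) q) f (A S fun i => f (S i))} ≥ 1 / 2 := by
  have hP : IsProbabilityMeasure (hardD x0 (8 * ε) q) :=
    hardD_prob x0 _ q 1 hk hq hqk (by linarith)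
  set g := A (fun _ => x0) (fun _ => false) with hg
  refine ⟨fun x => if x = x1 then !(g x1) else false, ?_⟩
  have hmem : ({fun _ => x0} : Set (Fin n → X)) ⊆ {S | ENNReal.ofReal ε ≤
      err (hardD x0 (8 * ε) q) (fun x => if x = x1 then !(g x1) else false)
        (A S fun i => (fun x => if x = x1 then !(g x1) else false) (S i))} := by
    intro S hS
    rw [Set.mem_singleton_iff] at hS
    subst hS
    simp only [Set.mem_ofPred_eq, if_neg hx.symm]
    rw [← hg]
    apply err_ge x0 _ q ε 1 hq hqk {x1} (by simpa using hx.symm)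
    rw [Finset.filter_true_of_mem]
    · simp
    · intro x hx
      rw [Finset.mem_singleton] at hx
      subst hx
      simp
  refine le_trans ?_ (measure_mono hmem)
  rw [Measure.pi_singleton]
  simp only [hardD_x0, Finset.prod_const, Finset.card_univ, Fintype.card_fin]
  rw [← ENNReal.ofReal_pow (by linarith)]
  have hb := one_add_mul_le_pow (a := -(8 * ε)) (by linarith) n
  have : (1 / 2 : ℝ) ≤ (1 - 8 * ε) ^ n := by
    rw [sub_eq_add_neg]
    refine le_trans ?_ hb
    push_cast at hn
    linarith
  refine le_trans (le_of_eq ?_) (ENNReal.ofReal_le_ofReal this)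
  rw [ENNReal.ofReal_div_of_pos (by norm_num)]
  simp

end helpers

/-- with `X` finite of size `m ≥ 2`, `Y = {0,1}`, and `F = G` all functions
`X → Y`: (i) `F` is (0,0)-distillable into `G` using 0 samples; (ii) for any `0 < ε ≤ 1/16`,
no learner with `n ≤ (m−1)/(64ε)` samples can (ε, 1/2)-learn `F` with `G`: for every
`Alearn` there are a distribution `D` and a concept `f` with
`P_{S ~ D^n}[error_{f,D}(Alearn(S, labels)) ≥ ε] ≥ 1/2`. -/
theorem distilling_strictly_easier_than_learning {X : Type*}
    [Fintype X] [MeasurableSpace X] [MeasurableSingletonClass X]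
    (hm : 2 ≤ Fintype.card X) :
    (∃ Adist : (Fin 0 → X) → (X → Bool) → (X → Bool),
      ∀ (D : Measure X), IsProbabilityMeasure D → ∀ f : X → Bool,
        (Measure.pi fun _ : Fin 0 => D)
            {S | err D f (Adist S f) ≤ ENNReal.ofReal 0}
          ≥ 1 - ENNReal.ofReal 0) ∧
    (∀ ε : ℝ, 0 < ε → ε ≤ 1 / 16 →
      ∀ n : ℕ, (n : ℝ) ≤ ((Fintype.card X : ℝ) - 1) / (64 * ε) →
      ∀ Alearn : (Fin n → X) → (Fin n → Bool) → (X → Bool),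
        ∃ (D : Measure X) (_ : IsProbabilityMeasure D) (f : X → Bool),
          (Measure.pi fun _ : Fin n => D)
              {S | ENNReal.ofReal ε ≤ err D f (Alearn S fun i => f (S i))}
            ≥ 1 / 2) := by
  refine ⟨⟨fun _ f => f, fun D hD f => by simp [err]⟩, ?_⟩
  intro ε hε0 hε n hn A
  obtain ⟨k, hk⟩ : ∃ k, Fintype.card X = k + 1 := ⟨Fintype.card X - 1, by omega⟩
  have hk1 : 1 ≤ k := by omega
  have hkR : (0 : ℝ) < k := by exact_mod_cast hk1
  have hn' : n * (8 * ε) ≤ (k : ℝ) / 8 := by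
    rw [hk, le_div_iff₀ (by positivity)] at hn
    push_cast at hn
    linarith
  obtain ⟨x0, x1, hne⟩ := Fintype.one_lt_card_iff.1 (show 1 < Fintype.card X by omega)
  have hq : 0 ≤ 8 * ε / k := by positivity
  have hqk : 8 * ε / k * k = 8 * ε := by field_simp
  refine ⟨hardD x0 (8 * ε) (8 * ε / k), hardD_prob x0 _ _ k hk hq hqk (by linarith), ?_⟩
  rcases Nat.lt_or_ge k 2 with h | h
  · obtain rfl : k = 1 := by omega
    exact case_two x0 x1 hne.symm ε _ n hk hε0 hε hq hqk hn' A
  · exact case_large x0 ε _ k n h hk hε hq hqk hn' A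
end

section
/- Suppose the input space X is finite and nonempty, Y is a label space, and F, G ⊆ Y^X are such that F is perfectly distillable into G, i.e., for every 0 < ε < 1 and 0 < δ < 1 there exist some n and an n-sample algorithm that (ε,δ)-distills F into G. Then F ⊆ G (every f ∈ F equals some g ∈ G as a function), and consequently F is (ε=0, δ=0)-distillable into G using 0 samples. -/
open MeasureTheory

/-- if the input space `X` is finite and nonempty and `F` is perfectly
distillable into `G` (for every `0 < ε < 1`, `0 < δ < 1` there exist `n` and an `n`-sample
(ε,δ)-distillation algorithm), then `F ⊆ G`, and consequently `F` is (0,0)-distillable into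
`G` with 0 samples. -/
theorem perfect_distillation_finite {X Y : Type*}
    [Fintype X] [Nonempty X] [MeasurableSpace X] [MeasurableSingletonClass X]
    (F G : Set (X → Y))
    (hperf : ∀ ε δ : ℝ, 0 < ε → ε < 1 → 0 < δ → δ < 1 →
      ∃ (n : ℕ) (A : (Fin n → X) → (X → Y) → (X → Y)),
        (∀ S f, f ∈ F → A S f ∈ G) ∧
        ∀ (D : Measure X), IsProbabilityMeasure D → ∀ f ∈ F,
          (Measure.pi fun _ : Fin n => D)
              {S | err D f (A S f) ≤ ENNReal.ofReal ε}
            ≥ 1 - ENNReal.ofReal δ) :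
    F ⊆ G ∧
    ∃ A : (Fin 0 → X) → (X → Y) → (X → Y),
      (∀ S f, f ∈ F → A S f ∈ G) ∧
      ∀ (D : Measure X), IsProbabilityMeasure D → ∀ f ∈ F,
        (Measure.pi fun _ : Fin 0 => D)
            {S | err D f (A S f) ≤ ENNReal.ofReal 0}
          ≥ 1 - ENNReal.ofReal 0 := by
  have hFG : F ⊆ G := by
    intro f hf
    have hc : (0 : ℝ) < Fintype.card X := by exact_mod_cast Fintype.card_pos
    obtain ⟨n, A, hA, hD⟩ := hperf (1 / ((Fintype.card X : ℝ) + 1)) (1 / 2)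
      (by positivity) (by rw [div_lt_one (by positivity)]; linarith) (by norm_num) (by norm_num)
    have hc0 : (Fintype.card X : ENNReal) ≠ 0 := by simp
    have hct : (Fintype.card X : ENNReal) ≠ ⊤ := ENNReal.natCast_ne_top _
    let D : Measure X := (Fintype.card X : ENNReal)⁻¹ • Measure.count
    have hP : IsProbabilityMeasure D := by
      constructor
      simp only [D, Measure.smul_apply, smul_eq_mul, Measure.count_univ]
      rw [ENat.card_eq_coe_fintype_card]
      exact ENNReal.inv_mul_cancel hc0 hct
    have h := hD D hP f hf
    have hne : {S | err D f (A S f) ≤ ENNReal.ofReal (1 / ((Fintype.card X : ℝ) + 1))}.Nonempty := by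
      rw [Set.nonempty_iff_ne_empty]
      intro he
      rw [he, measure_empty] at h
      have h2 : (1 : ENNReal) ≤ ENNReal.ofReal (1 / 2) := tsub_eq_zero_iff_le.mp (le_antisymm h bot_le)
      rw [ENNReal.one_le_ofReal] at h2
      norm_num at h2
    obtain ⟨S, hS⟩ := hne
    have heq : A S f = f := by
      funext x
      by_contra hx
      have h1 : D {x} ≤ err D f (A S f) := measure_mono (by simpa using hx)
      have h2 : D {x} = ENNReal.ofReal (1 / (Fintype.card X : ℝ)) := by
        simp only [D, Measure.smul_apply, smul_eq_mul, Measure.count_singleton, mul_one]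
        rw [one_div, ENNReal.ofReal_inv_of_pos hc, ENNReal.ofReal_natCast]
      rw [h2] at h1
      have h3 := h1.trans hS
      rw [ENNReal.ofReal_le_ofReal_iff (by positivity)] at h3
      have h4 : 1 / ((Fintype.card X : ℝ) + 1) < 1 / (Fintype.card X : ℝ) :=
        one_div_lt_one_div_of_lt hc (by linarith)
      linarith
    rw [← heq]
    exact hA S f hf
  refine ⟨hFG, fun _ f => f, fun _ f hf => hFG hf, fun D _ f _ => ?_⟩
  simp [err]
end

section
/- Suppose the input space X is countable, Y is a label space, and F, G ⊆ Y^X are such that F is perfectly distillable into G. Then for every 0 < ε < 1 and 0 < δ < 1, the class F is (ε,δ)-distillable into G using n(ε,δ) = ⌈log(1/δ)/ε⌉ samples; i.e., there exists a map A_dist : X^n × F → G with n = ⌈log(1/δ)/ε⌉ such that for every probability distribution D on X and every f ∈ F, P_{S~D^n}[ error_{f,D}(A_dist(S,f)) ≤ ε ] ≥ 1 − δ. -/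
open MeasureTheory

theorem exists_agree_aux {X Y : Type*}
    [Countable X] [MeasurableSpace X] [MeasurableSingletonClass X]
    (F G : Set (X → Y))
    (hperf : ∀ ε δ : ℝ, 0 < ε → ε < 1 → 0 < δ → δ < 1 →
      ∃ (n : ℕ) (A : (Fin n → X) → (X → Y) → (X → Y)),
        (∀ S f, f ∈ F → A S f ∈ G) ∧
        ∀ (D : Measure X), IsProbabilityMeasure D → ∀ f ∈ F,
          (Measure.pi fun _ : Fin n => D)
              {S | err D f (A S f) ≤ ENNReal.ofReal ε}
            ≥ 1 - ENNReal.ofReal δ)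
    (f : X → Y) (hf : f ∈ F) (T : Finset X) (hT : T.Nonempty) :
    ∃ g ∈ G, ∀ x ∈ T, g x = f x := by
  have hc : (0 : ℝ) < T.card := by exact_mod_cast hT.card_pos
  obtain ⟨n, A, hA, h⟩ := hperf (1 / (T.card + 1)) (1 / 2) (by positivity)
    (by rw [div_lt_one (by positivity)]; linarith) (by norm_num) (by norm_num)
  have h1 := h (PMF.uniformOfFinset T hT).toMeasure inferInstance f hf
  have hne : {S | err (PMF.uniformOfFinset T hT).toMeasure f (A S f) ≤
      ENNReal.ofReal (1 / (T.card + 1))}.Nonempty := by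
    rw [Set.nonempty_iff_ne_empty]
    intro he
    rw [he, measure_empty] at h1
    have h2 : (1 : ENNReal) ≤ ENNReal.ofReal (1 / 2) := by
      simpa using h1
    rw [ENNReal.one_le_ofReal] at h2
    norm_num at h2
  obtain ⟨S, hS⟩ := hne
  refine ⟨A S f, hA S f hf, fun x hx => ?_⟩
  by_contra hxn
  have h3 : (PMF.uniformOfFinset T hT).toMeasure {x} ≤ ENNReal.ofReal (1 / (T.card + 1)) :=
    (measure_mono (by simpa using hxn)).trans hS
  rw [PMF.toMeasure_apply_singleton _ _ (measurableSet_singleton x),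
    PMF.uniformOfFinset_apply_of_mem hT hx] at h3
  have h4 : ((T.card : ENNReal))⁻¹ = ENNReal.ofReal (1 / T.card) := by
    rw [one_div, ENNReal.ofReal_inv_of_pos hc, ENNReal.ofReal_natCast]
  rw [h4, ENNReal.ofReal_le_ofReal_iff (by positivity)] at h3
  have : 1 / ((T.card : ℝ) + 1) < 1 / T.card := one_div_lt_one_div_of_lt hc (by linarith)
  linarith

/-- if the input space `X` is countable and `F` is perfectly distillable into
`G`, then for every `0 < ε < 1` and `0 < δ < 1`, `F` is (ε,δ)-distillable into `G` using
`n = ⌈log(1/δ)/ε⌉` samples. -/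
theorem perfect_distillation_countable {X Y : Type*}
    [Countable X] [MeasurableSpace X] [MeasurableSingletonClass X]
    (F G : Set (X → Y))
    (hperf : ∀ ε δ : ℝ, 0 < ε → ε < 1 → 0 < δ → δ < 1 →
      ∃ (n : ℕ) (A : (Fin n → X) → (X → Y) → (X → Y)),
        (∀ S f, f ∈ F → A S f ∈ G) ∧
        ∀ (D : Measure X), IsProbabilityMeasure D → ∀ f ∈ F,
          (Measure.pi fun _ : Fin n => D)
              {S | err D f (A S f) ≤ ENNReal.ofReal ε}
            ≥ 1 - ENNReal.ofReal δ)
    (ε δ : ℝ) (hε0 : 0 < ε) (hε1 : ε < 1) (hδ0 : 0 < δ) (hδ1 : δ < 1) :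
    ∃ A : (Fin ⌈Real.log (1 / δ) / ε⌉₊ → X) → (X → Y) → (X → Y),
      (∀ S f, f ∈ F → A S f ∈ G) ∧
      ∀ (D : Measure X), IsProbabilityMeasure D → ∀ f ∈ F,
        (Measure.pi fun _ : Fin ⌈Real.log (1 / δ) / ε⌉₊ => D)
            {S | err D f (A S f) ≤ ENNReal.ofReal ε}
          ≥ 1 - ENNReal.ofReal δ := by
  classical
  obtain ⟨e, he⟩ := exists_injective_nat X
  have hlog : 0 < Real.log (1 / δ) := Real.log_pos (by rw [lt_div_iff₀ hδ0]; linarith)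
  generalize hn : ⌈Real.log (1 / δ) / ε⌉₊ = n
  have hnle : Real.log (1 / δ) / ε ≤ n := hn ▸ Nat.le_ceil _
  have hnpos : 0 < n := by
    rw [← hn]; exact Nat.ceil_pos.mpr (by positivity)
  have key : ∀ (S : Fin n → X) (f : X → Y), ∃ g : X → Y, f ∈ F →
      g ∈ G ∧ ∀ i x, e x ≤ e (S i) → g x = f x := by
    intro S f
    by_cases hf : f ∈ F
    · have hfin : (⋃ i, {x | e x ≤ e (S i)}).Finite :=
        Set.finite_iUnion fun i => (Set.finite_Iic (e (S i))).preimage he.injOn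
      obtain ⟨g, hg, hgx⟩ := exists_agree_aux F G hperf f hf hfin.toFinset
        ⟨S ⟨0, hnpos⟩, by simpa using ⟨⟨0, hnpos⟩, le_rfl⟩⟩
      refine ⟨g, fun _ => ⟨hg, fun i x hx => hgx x ?_⟩⟩
      simpa using ⟨i, hx⟩
    · exact ⟨f, fun h => absurd h hf⟩
  choose A hA using key
  refine ⟨A, fun S f hf => (hA S f hf).1, fun D hD f hf => ?_⟩
  have hms : ∀ s : Set X, MeasurableSet s := fun s => s.to_countable.measurableSet
  have hex : ∃ k, D {x | k ≤ e x} ≤ ENNReal.ofReal ε := by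
    have ht : Filter.Tendsto (fun k : ℕ => D {x | k ≤ e x}) Filter.atTop
        (nhds (D (⋂ k : ℕ, {x | k ≤ e x}))) :=
      tendsto_measure_iInter_atTop (fun _ => (hms _).nullMeasurableSet)
        (fun a b hab x hx => le_trans hab hx) ⟨0, measure_ne_top _ _⟩
    have h0 : (⋂ k : ℕ, {x | k ≤ e x}) = ∅ := by
      ext x
      simp only [Set.mem_iInter, Set.mem_ofPred_eq, Set.mem_empty_iff_false, iff_false]
      intro h
      exact absurd (h (e x + 1)) (by omega)
    rw [h0, measure_empty] at ht
    exact (ht.eventually_le_const (ENNReal.ofReal_pos.mpr hε0)).exists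
  have hk0 : Nat.find hex ≠ 0 := by
    intro h0
    have := Nat.find_spec hex
    rw [h0] at this
    simp only [zero_le, Set.ofPred_true, measure_univ, ENNReal.one_le_ofReal] at this
    linarith
  obtain ⟨j, hj⟩ := Nat.exists_eq_succ_of_ne_zero hk0
  have hspec := Nat.find_spec hex
  rw [hj] at hspec
  have hmin : ¬ D {x | j ≤ e x} ≤ ENNReal.ofReal ε := Nat.find_min hex (by omega)
  have hsub : (Set.univ.pi fun _ : Fin n => {x | j ≤ e x}ᶜ)ᶜ ⊆
      {S | err D f (A S f) ≤ ENNReal.ofReal ε} := by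
    intro S hS
    simp only [Set.mem_compl_iff, Set.mem_pi, Set.mem_univ, true_imp_iff, Set.mem_ofPred_eq,
      not_forall, not_not] at hS
    obtain ⟨i, hi⟩ := hS
    refine le_trans (measure_mono ?_) hspec
    intro x hx
    by_contra hlt
    have hlt' : e x < j + 1 := not_le.mp hlt
    exact hx ((hA S f hf).2 i x (by omega))
  refine le_trans ?_ (measure_mono hsub)
  rw [prob_compl_eq_one_sub (MeasurableSet.univ_pi fun _ => hms _), Measure.pi_pi]
  refine tsub_le_tsub_left ?_ _
  rw [Finset.prod_const, Finset.card_univ, Fintype.card_fin, prob_compl_eq_one_sub (hms _)]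
  have h1 : 1 - D {x | j ≤ e x} ≤ ENNReal.ofReal (1 - ε) := by
    rw [ENNReal.ofReal_sub _ hε0.le, ENNReal.ofReal_one]
    exact tsub_le_tsub_left (not_le.mp hmin).le _
  refine (pow_le_pow_left' h1 n).trans ?_
  rw [← ENNReal.ofReal_pow (by linarith)]
  apply ENNReal.ofReal_le_ofReal
  have h2 : 1 - ε ≤ Real.exp (-ε) := Real.one_sub_le_exp_neg ε
  calc (1 - ε) ^ n ≤ Real.exp (-ε) ^ n := pow_le_pow_left₀ (by linarith) h2 n
    _ = Real.exp (n * (-ε)) := (Real.exp_nat_mul _ _).symm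
    _ ≤ Real.exp (Real.log δ) := by
      apply Real.exp_le_exp.mpr
      rw [div_le_iff₀ hε0, one_div, Real.log_inv] at hnle
      linarith
    _ = δ := Real.exp_log hδ0
end

section
/- Reduction to binary labels and a singleton source class: for classes F, G ⊆ Y^X, sample size n, and parameters ε, δ, the following are equivalent: (a) F is (ε,δ)-distillable into G in n samples; (b) for every f ∈ F, the singleton class {f} is (ε,δ)-distillable into G in n samples; (c) for every f ∈ F, the singleton class {zero} ⊆ {0,1}^X is (ε,δ)-distillable into the class f ⊕ G ⊆ {0,1}^X in n samples. Moreover the same equivalences hold with 'agnostically (ε,δ)-distillable' in place of '(ε,δ)-distillable'. -/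
open MeasureTheory

/-- `F` is (ε,δ)-distillable into `G` in `n` samples. -/
def Distillable {X Y : Type*} [MeasurableSpace X] (F G : Set (X → Y)) (n : ℕ) (ε δ : ℝ) :
    Prop :=
  ∃ A : (Fin n → X) → (X → Y) → (X → Y),
    (∀ S f, f ∈ F → A S f ∈ G) ∧
    ∀ (D : Measure X), IsProbabilityMeasure D → ∀ f ∈ F,
      (Measure.pi fun _ : Fin n => D) {S | err D f (A S f) ≤ ENNReal.ofReal ε}
        ≥ 1 - ENNReal.ofReal δ

/-- `F` is agnostically (ε,δ)-distillable into `G` in `n` samples. -/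
def AgnosticallyDistillable {X Y : Type*} [MeasurableSpace X] (F G : Set (X → Y)) (n : ℕ)
    (ε δ : ℝ) : Prop :=
  ∃ A : (Fin n → X) → (X → Y) → (X → Y),
    (∀ S f, f ∈ F → A S f ∈ G) ∧
    ∀ (D : Measure X), IsProbabilityMeasure D → ∀ f ∈ F,
      (Measure.pi fun _ : Fin n => D)
          {S | err D f (A S f) - ⨅ g ∈ G, err D f g ≤ ENNReal.ofReal ε}
        ≥ 1 - ENNReal.ofReal δ

/-- `(f ⊕ g)(x) = 1(f x ≠ g x)`. -/
noncomputable def xorFn {X Y : Type*} (f g : X → Y) : X → Bool :=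
  fun x => @decide (f x ≠ g x) (Classical.propDecidable _)

/-- `f ⊕ G = { f ⊕ g : g ∈ G } ⊆ {0,1}^X`. -/
noncomputable def xorClass {X Y : Type*} (f : X → Y) (G : Set (X → Y)) : Set (X → Bool) :=
  (fun g => xorFn f g) '' G

lemma err_xorFn {X Y : Type*} [MeasurableSpace X] (D : Measure X) (f g : X → Y) :
    err D (fun _ => false) (xorFn f g) = err D f g := by
  unfold err xorFn
  congr 1
  ext x
  simpa using not_congr (eq_comm (a := f x) (b := g x))

lemma iInf_err_xorClass {X Y : Type*} [MeasurableSpace X] (D : Measure X) (f : X → Y)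
    (G : Set (X → Y)) :
    ⨅ g ∈ xorClass f G, err D (fun _ => false) g = ⨅ g ∈ G, err D f g := by
  unfold xorClass
  rw [iInf_image]
  simp only [err_xorFn]

lemma distillable_iff {X Y : Type*} [MeasurableSpace X] (F G : Set (X → Y)) (n : ℕ) (ε δ : ℝ) :
    Distillable F G n ε δ ↔ ∀ f ∈ F, ∃ a : (Fin n → X) → (X → Y), (∀ S, a S ∈ G) ∧
      ∀ (D : Measure X), IsProbabilityMeasure D →
        (Measure.pi fun _ : Fin n => D) {S | err D f (a S) ≤ ENNReal.ofReal ε}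
          ≥ 1 - ENNReal.ofReal δ := by
  classical
  constructor
  · rintro ⟨A, h1, h2⟩ f hf
    exact ⟨fun S => A S f, fun S => h1 S f hf, fun D hD => h2 D hD f hf⟩
  · intro h
    choose a h1 h2 using h
    refine ⟨fun S f => if hf : f ∈ F then a f hf S else f, ?_, ?_⟩
    · intro S f hf
      simpa [hf] using h1 f hf S
    · intro D hD f hf
      simpa only [hf, dif_pos] using h2 f hf D hD

lemma agnosticallyDistillable_iff {X Y : Type*} [MeasurableSpace X] (F G : Set (X → Y)) (n : ℕ)
    (ε δ : ℝ) :
    AgnosticallyDistillable F G n ε δ ↔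
      ∀ f ∈ F, ∃ a : (Fin n → X) → (X → Y), (∀ S, a S ∈ G) ∧
      ∀ (D : Measure X), IsProbabilityMeasure D →
        (Measure.pi fun _ : Fin n => D)
          {S | err D f (a S) - ⨅ g ∈ G, err D f g ≤ ENNReal.ofReal ε}
          ≥ 1 - ENNReal.ofReal δ := by
  classical
  constructor
  · rintro ⟨A, h1, h2⟩ f hf
    exact ⟨fun S => A S f, fun S => h1 S f hf, fun D hD => h2 D hD f hf⟩
  · intro h
    choose a h1 h2 using h
    refine ⟨fun S f => if hf : f ∈ F then a f hf S else f, ?_, ?_⟩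
    · intro S f hf
      simpa [hf] using h1 f hf S
    · intro D hD f hf
      simpa only [hf, dif_pos] using h2 f hf D hD

/-- Selections from `f ⊕ G` are the same as selections from `G`. -/
lemma exists_xorClass_iff {X Y S : Type*} (f : X → Y) (G : Set (X → Y))
    (P : (S → (X → Bool)) → Prop) :
    (∃ a : S → (X → Bool), (∀ s, a s ∈ xorClass f G) ∧ P a) ↔
      ∃ a : S → (X → Y), (∀ s, a s ∈ G) ∧ P (fun s => xorFn f (a s)) := by
  constructor
  · rintro ⟨a, h1, h2⟩
    choose b hb hba using h1
    refine ⟨b, hb, ?_⟩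
    have : (fun s => xorFn f (b s)) = a := funext hba
    rwa [this]
  · rintro ⟨a, h1, h2⟩
    exact ⟨_, fun s => ⟨a s, h1 s, rfl⟩, h2⟩

/-- (a) `F` is (ε,δ)-distillable into `G` in `n` samples iff (b) for every
`f ∈ F` the singleton `{f}` is, iff (c) for every `f ∈ F` the singleton `{zero}` is
(ε,δ)-distillable into `f ⊕ G`.  The same equivalences hold for agnostic distillation. -/
theorem reduction_to_binary_singleton {X Y : Type*} [MeasurableSpace X]
    (F G : Set (X → Y)) (n : ℕ) (ε δ : ℝ) :
    ((Distillable F G n ε δ ↔ ∀ f ∈ F, Distillable {f} G n ε δ) ∧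
      (Distillable F G n ε δ ↔
        ∀ f ∈ F, Distillable ({fun _ => false} : Set (X → Bool)) (xorClass f G) n ε δ)) ∧
    ((AgnosticallyDistillable F G n ε δ ↔
        ∀ f ∈ F, AgnosticallyDistillable {f} G n ε δ) ∧
      (AgnosticallyDistillable F G n ε δ ↔
        ∀ f ∈ F, AgnosticallyDistillable ({fun _ => false} : Set (X → Bool))
          (xorClass f G) n ε δ)) := by
  refine ⟨⟨?_, ?_⟩, ?_, ?_⟩
  · simp only [distillable_iff, Set.mem_singleton_iff, forall_eq]
  · simp only [distillable_iff, Set.mem_singleton_iff, forall_eq, exists_xorClass_iff, err_xorFn]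
  · simp only [agnosticallyDistillable_iff, Set.mem_singleton_iff, forall_eq]
  · simp only [agnosticallyDistillable_iff, Set.mem_singleton_iff, forall_eq,
      exists_xorClass_iff, err_xorFn, iInf_err_xorClass]
end

section
/- Reduction to the Pareto frontier: let the source class be F = {zero} ⊆ {0,1}^X and the target class G ⊆ {0,1}^X. Define the Pareto partial order on distinct g, g' ∈ G by g ≺_Par g' iff g(x) = 0 implies g'(x) = 0 for all x, and let PF(G) = { g ∈ G : there is no g' ∈ G with g ≺_Par g' }. Assume every g ∈ G is Pareto-dominated by some element of PF(G). Then for any n, ε, δ, the class {zero} is (ε,δ)-distillable into G in n samples if and only if {zero} is (ε,δ)-distillable into PF(G) in n samples; and the same equivalence holds for agnostic (ε,δ)-distillation. -/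
open MeasureTheory

/-- The Pareto partial order on distinct `g, g' : X → Bool`:
`g ≺ g'` iff `g ≠ g'` and `g x = 0` implies `g' x = 0` for all `x`. -/
def ParetoLT {X : Type*} (g g' : X → Bool) : Prop :=
  g ≠ g' ∧ ∀ x, g x = false → g' x = false

/-- The Pareto frontier: the maximal elements of `G` under the Pareto order. -/
def PF {X : Type*} (G : Set (X → Bool)) : Set (X → Bool) :=
  {g ∈ G | ¬ ∃ g' ∈ G, ParetoLT g g'}

/-- assuming every `g ∈ G` is Pareto-dominated by some element of `PF(G)`,
the class `{zero}` is (ε,δ)-distillable into `G` in `n` samples iff it is (ε,δ)-distillable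
into `PF(G)` in `n` samples; the same holds for agnostic distillation. -/
theorem reduction_to_pareto_frontier {X : Type*} [MeasurableSpace X]
    (G : Set (X → Bool)) (n : ℕ) (ε δ : ℝ)
    (hdom : ∀ g ∈ G, ∃ g' ∈ PF G, ∀ x, g x = false → g' x = false) :
    (Distillable ({fun _ => false} : Set (X → Bool)) G n ε δ ↔
      Distillable ({fun _ => false} : Set (X → Bool)) (PF G) n ε δ) ∧
    (AgnosticallyDistillable ({fun _ => false} : Set (X → Bool)) G n ε δ ↔
      AgnosticallyDistillable ({fun _ => false} : Set (X → Bool)) (PF G) n ε δ) := by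
  classical
  have hsub : ∀ g, g ∈ PF G → g ∈ G := fun g hg => hg.1
  have hmono : ∀ (D : Measure X) (g g' : X → Bool), (∀ x, g x = false → g' x = false) →
      err D (fun _ => false) g' ≤ err D (fun _ => false) g := by
    intro D g g' h
    exact measure_mono (fun x hx hg => hx (h x hg))
  have hinf : ∀ D : Measure X, (⨅ g ∈ PF G, err D (fun _ => false) g)
      = ⨅ g ∈ G, err D (fun _ => false) g := by
    intro D
    apply le_antisymm
    · refine le_iInf₂ fun g hg => ?_
      obtain ⟨g', hg', h⟩ := hdom g hg
      exact (iInf₂_le g' hg').trans (hmono D g g' h)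
    · exact le_iInf₂ fun g hg => iInf₂_le g (hsub g hg)
  choose! p hp hp2 using hdom
  refine ⟨⟨?_, ?_⟩, ⟨?_, ?_⟩⟩
  · rintro ⟨A, hA, h⟩
    refine ⟨fun S f => p (A S f), fun S f hf => hp _ (hA S f hf), fun D hD f hf => ?_⟩
    refine ge_trans (measure_mono fun S hS => ?_) (h D hD f hf)
    have hG := hA S f hf
    obtain rfl := hf
    exact (hmono D _ _ (hp2 _ hG)).trans hS
  · rintro ⟨A, hA, h⟩
    exact ⟨A, fun S f hf => hsub _ (hA S f hf), h⟩
  · rintro ⟨A, hA, h⟩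
    refine ⟨fun S f => p (A S f), fun S f hf => hp _ (hA S f hf), fun D hD f hf => ?_⟩
    refine ge_trans (measure_mono fun S hS => ?_) (h D hD f hf)
    have hG := hA S f hf
    obtain rfl := hf
    simp only [Set.mem_setOf_eq, hinf] at hS ⊢
    exact (tsub_le_tsub_right (hmono D _ _ (hp2 _ hG)) _).trans hS
  · rintro ⟨A, hA, h⟩
    refine ⟨A, fun S f hf => hsub _ (hA S f hf), fun D hD f hf => ?_⟩
    have h1 := h D hD f hf
    obtain rfl := hf
    simpa only [hinf] using h1
end

section
/- Exactly linearly representing many AND functions requires high norm: let S be a collection of nondegenerate k-clauses over d Boolean variables such that distinct clauses S ≠ S' ∈ S have distinct index sets I(S) ≠ I(S'). Let φ : {+1,−1}^d → ℝ^m be any map, and suppose that for every clause S ∈ S there exists w_S ∈ ℝ^m with ‖w_S‖ ≤ τ and w_S · φ(x) = AND_S(x) for all x ∈ {+1,−1}^d. Let β² = E_{x ~ Unif{+1,−1}^d}[ ‖φ(x)‖² ]. Then β² τ² ≥ 2^{−2k−2} |S|. -/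
open scoped RealInnerProductSpace

/-- A clause over `d` Boolean variables, given as a partial assignment: `S i = some b`
means the literal requiring variable `i` to have value `b` is in the clause, and
`S i = none` means variable `i` does not appear.  This representation is automatically
nondegenerate (no variable appears both positively and negatively). -/
abbrev Clause (d : ℕ) := Fin d → Option Bool

/-- The number of literals in a clause. -/
def clauseCard {d : ℕ} (S : Clause d) : ℕ :=
  (Finset.univ.filter fun i => S i ≠ none).card

/-- The index set `I(S)` of a clause. -/
def idxSet {d : ℕ} (S : Clause d) : Finset (Fin d) :=
  Finset.univ.filter fun i => S i ≠ none

/-- `AND_S(x) = 1` if `x` satisfies every literal of `S`, else `0` (here `true` encodes +1). -/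
def andFn {d : ℕ} (S : Clause d) (x : Fin d → Bool) : ℝ :=
  if ∀ i : Fin d, ∀ b : Bool, S i = some b → x i = b then 1 else 0

/-- sign of a Boolean -/
def sgnB (b : Bool) : ℝ := if b then 1 else -1

/-- parity character of the index set of a clause -/
def chiC {d : ℕ} (S : Clause d) (x : Fin d → Bool) : ℝ :=
  ∏ i, if S i = none then 1 else sgnB (x i)

theorem sum_prod_bool {d : ℕ} (g : Fin d → Bool → ℝ) :
    ∑ x : Fin d → Bool, ∏ i, g i (x i) = ∏ i, (g i true + g i false) := by
  have h := Finset.prod_univ_sum (fun _ : Fin d => (Finset.univ : Finset Bool)) g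
  simp only [Fintype.piFinset_univ, Fintype.sum_bool] at h
  exact h.symm

theorem chi_self {d : ℕ} (S : Clause d) :
    ∑ x : Fin d → Bool, chiC S x * chiC S x = 2 ^ d := by
  simp only [chiC, ← Finset.prod_mul_distrib]
  rw [sum_prod_bool (fun i b => (if S i = none then (1:ℝ) else sgnB b) *
    (if S i = none then 1 else sgnB b))]
  rw [Finset.prod_congr rfl (g := fun _ => (2:ℝ))]
  · simp
  · intro i _
    by_cases h : S i = none <;> simp [h, sgnB] <;> norm_num

theorem chi_ne {d : ℕ} (S T : Clause d) (h : idxSet S ≠ idxSet T) :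
    ∑ x : Fin d → Bool, chiC S x * chiC T x = 0 := by
  simp only [chiC, ← Finset.prod_mul_distrib]
  rw [sum_prod_bool (fun i b => (if S i = none then (1:ℝ) else sgnB b) *
    (if T i = none then 1 else sgnB b))]
  have : ∃ i, ¬ (S i = none ↔ T i = none) := by
    by_contra! hc
    apply h
    ext i
    simp [idxSet, hc i]
  obtain ⟨i, hi⟩ := this
  apply Finset.prod_eq_zero (Finset.mem_univ i)
  by_cases h1 : S i = none <;> by_cases h2 : T i = none <;> simp_all [sgnB]

theorem andFn_prod {d : ℕ} (S : Clause d) (x : Fin d → Bool) :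
    andFn S x = ∏ i, if S i = none ∨ S i = some (x i) then (1:ℝ) else 0 := by
  rw [andFn]
  split_ifs with h
  · rw [Finset.prod_eq_one]
    intro i _
    rw [if_pos]
    rcases hS : S i with _ | b
    · simp
    · simp [h i b hS]
  · push Not at h
    obtain ⟨i, b, hS, hb⟩ := h
    rw [Finset.prod_eq_zero (Finset.mem_univ i)]
    simp [hS, Ne.symm hb]

theorem chi_and {d : ℕ} (S : Clause d) :
    (∑ x : Fin d → Bool, chiC S x * andFn S x) ^ 2 * 4 ^ clauseCard S = (2 ^ d) ^ 2 := by
  simp only [chiC, andFn_prod, ← Finset.prod_mul_distrib]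
  rw [sum_prod_bool (fun i b => (if S i = none then (1:ℝ) else sgnB b) *
    (if S i = none ∨ S i = some b then 1 else 0))]
  have h4 : (4:ℝ) ^ clauseCard S = ∏ i, if S i ≠ none then (4:ℝ) else 1 := by
    rw [Finset.prod_ite]
    simp [clauseCard]
  rw [h4, ← Finset.prod_pow, ← Finset.prod_mul_distrib]
  rw [Finset.prod_congr rfl (g := fun _ => (4:ℝ))]
  · simp only [Finset.prod_const, Finset.card_univ, Fintype.card_fin]
    rw [← pow_mul, mul_comm, pow_mul]; norm_num
  · intro i _
    rcases hS : S i with _ | b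
    · norm_num
    · cases b <;> simp [sgnB]

theorem bessel_aux {d : ℕ} {E : Type*} [NormedAddCommGroup E] [InnerProductSpace ℝ E]
    (𝒮 : Finset (Clause d))
    (hdistinct : ∀ S ∈ 𝒮, ∀ S' ∈ 𝒮, S ≠ S' → idxSet S ≠ idxSet S')
    (φ : (Fin d → Bool) → E) :
    ∑ S ∈ 𝒮, ‖∑ x, chiC S x • φ x‖ ^ 2 ≤ 2 ^ d * ∑ x, ‖φ x‖ ^ 2 := by
  set N : ℝ := 2 ^ d with hN
  have hNpos : 0 < N := by positivity
  set u : Clause d → E := fun S => ∑ x, chiC S x • φ x with hu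
  have h0 : 0 ≤ ∑ x, ‖N • φ x - ∑ S ∈ 𝒮, chiC S x • u S‖ ^ 2 :=
    Finset.sum_nonneg fun _ _ => by positivity
  have hcross : ∑ x, ⟪φ x, ∑ S ∈ 𝒮, chiC S x • u S⟫ = ∑ S ∈ 𝒮, ‖u S‖ ^ 2 := by
    simp only [inner_sum]
    rw [Finset.sum_comm]
    refine Finset.sum_congr rfl fun S _ => ?_
    rw [← real_inner_self_eq_norm_sq]
    conv_rhs => rw [hu]
    simp only [sum_inner, real_inner_smul_left, real_inner_smul_right, hu]
  have hsq : ∑ x, ‖∑ S ∈ 𝒮, chiC S x • u S‖ ^ 2 = N * ∑ S ∈ 𝒮, ‖u S‖ ^ 2 := by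
    simp only [← real_inner_self_eq_norm_sq, sum_inner, inner_sum, real_inner_smul_left,
      real_inner_smul_right]
    rw [Finset.sum_comm, Finset.mul_sum]
    refine Finset.sum_congr rfl fun S hS => ?_
    rw [Finset.sum_comm, Finset.sum_eq_single_of_mem S hS]
    · rw [hN, ← chi_self S, Finset.sum_mul]
      exact Finset.sum_congr rfl fun x _ => by ring
    · intro T hT hne
      have := chi_ne S T (hdistinct S hS T hT hne.symm)
      rw [← zero_mul ⟪u S, u T⟫, ← this, Finset.sum_mul]
      exact Finset.sum_congr rfl fun x _ => by rw [real_inner_comm]; ring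
  have hexp : ∑ x, ‖N • φ x - ∑ S ∈ 𝒮, chiC S x • u S‖ ^ 2 =
      N ^ 2 * ∑ x, ‖φ x‖ ^ 2 - 2 * N * ∑ S ∈ 𝒮, ‖u S‖ ^ 2 + N * ∑ S ∈ 𝒮, ‖u S‖ ^ 2 := by
    rw [← hsq, ← hcross, Finset.mul_sum, Finset.mul_sum, ← Finset.sum_sub_distrib,
      ← Finset.sum_add_distrib]
    refine Finset.sum_congr rfl fun x _ => ?_
    rw [norm_sub_sq_real, real_inner_smul_left, norm_smul, mul_pow, Real.norm_eq_abs, sq_abs]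
    ring
  rw [hexp] at h0
  have : 0 ≤ N * (N * ∑ x, ‖φ x‖ ^ 2 - ∑ S ∈ 𝒮, ‖u S‖ ^ 2) := by linarith
  have := nonneg_of_mul_nonneg_right this hNpos
  linarith

/-- exactly linearly representing many ANDs requires high norm.  If `𝒮` is a
collection of nondegenerate `k`-clauses with pairwise distinct index sets, and
`φ : {±1}^d → ℝ^m` is such that each `AND_S`, `S ∈ 𝒮`, equals `⟪w_S, φ(·)⟫` exactly for some
`w_S` with `‖w_S‖ ≤ τ`, then `β² τ² ≥ 2^{−2k−2} |𝒮|` where `β² = E_x[‖φ(x)‖²]`. -/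
theorem exact_and_packing {d m k : ℕ} (𝒮 : Finset (Clause d))
    (hk : ∀ S ∈ 𝒮, clauseCard S = k)
    (hdistinct : ∀ S ∈ 𝒮, ∀ S' ∈ 𝒮, S ≠ S' → idxSet S ≠ idxSet S')
    (φ : (Fin d → Bool) → EuclideanSpace ℝ (Fin m)) (τ : ℝ)
    (w : Clause d → EuclideanSpace ℝ (Fin m))
    (hw : ∀ S ∈ 𝒮, ‖w S‖ ≤ τ)
    (hrep : ∀ S ∈ 𝒮, ∀ x : Fin d → Bool, ⟪w S, φ x⟫ = andFn S x) :
    (𝒮.card : ℝ) / 2 ^ (2 * k + 2) ≤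
      ((∑ x : Fin d → Bool, ‖φ x‖ ^ 2) / 2 ^ d) * τ ^ 2 := by
  have hB := bessel_aux 𝒮 hdistinct φ
  have hS : ∀ S ∈ 𝒮, ((2:ℝ) ^ d) ^ 2 ≤ 4 ^ k * τ ^ 2 * ‖∑ x, chiC S x • φ x‖ ^ 2 := by
    intro S hS
    have h1 := chi_and S
    rw [hk S hS] at h1
    have h2 : ∑ x, chiC S x * andFn S x = ⟪w S, ∑ x, chiC S x • φ x⟫ := by
      simp only [inner_sum, real_inner_smul_right, hrep S hS]
    rw [← h1, h2]
    have h3 := abs_real_inner_le_norm (w S) (∑ x, chiC S x • φ x)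
    have h4 : |⟪w S, ∑ x, chiC S x • φ x⟫| ≤ τ * ‖∑ x, chiC S x • φ x‖ :=
      h3.trans (mul_le_mul_of_nonneg_right (hw S hS) (norm_nonneg _))
    have h5 := pow_le_pow_left₀ (abs_nonneg _) h4 2
    rw [sq_abs, mul_pow] at h5
    have h6 : (0:ℝ) ≤ 4 ^ k := by positivity
    nlinarith
  have hsum := Finset.sum_le_sum hS
  rw [← Finset.mul_sum, Finset.sum_const, nsmul_eq_mul] at hsum
  have hN : (0:ℝ) < 2 ^ d := by positivity
  have hK : (0:ℝ) < 4 ^ k := by positivity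
  have hmain : (𝒮.card : ℝ) * 2 ^ d ≤ 4 ^ k * τ ^ 2 * ∑ x, ‖φ x‖ ^ 2 := by
    have h := hsum.trans (mul_le_mul_of_nonneg_left hB (by positivity))
    refine le_of_mul_le_mul_right ?_ hN
    linarith
  have hpow : (2:ℝ) ^ (2 * k + 2) = 4 ^ k * 4 := by
    rw [pow_add, pow_mul]; norm_num
  rw [hpow, div_mul_eq_mul_div, div_le_div_iff₀ (by positivity) hN]
  have hnn : 0 ≤ 4 ^ k * τ ^ 2 * ∑ x, ‖φ x‖ ^ 2 :=
    mul_nonneg (by positivity) (Finset.sum_nonneg fun _ _ => by positivity)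
  linarith
end

section
/- Matrix of exactly-represented AND features has lower-bounded singular values: let S be a collection of nondegenerate k-clauses over d variables with pairwise distinct index sets, let W ∈ ℝ^{S×m} be a matrix with rows indexed by S, and let Φ ∈ ℝ^{m×2^d} be the matrix whose column indexed by x ∈ {+1,−1}^d is φ(x) for some map φ : {+1,−1}^d → ℝ^m. If [WΦ]_{S,x} = AND_S(x) for all S ∈ S and x ∈ {+1,−1}^d, then W Φ Φᵀ Wᵀ ⪰ 2^{d−2k−2} · I, i.e., W Φ Φᵀ Wᵀ − 2^{d−2k−2} I is positive semidefinite. -/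
open Matrix

/-- per-coordinate factor of the AND function -/
noncomputable def hF (s : Option Bool) (y : Bool) : ℝ :=
  match s with
  | none => 1
  | some b => if y = b then 1 else 0

/-- per-coordinate factor of the scaled character -/
noncomputable def gF (s : Option Bool) (y : Bool) : ℝ :=
  match s with
  | none => 1
  | some b => if y = b then 1/2 else -1/2

theorem andFn_eq_prod {d : ℕ} (S : Clause d) (x : Fin d → Bool) :
    andFn S x = ∏ i, hF (S i) (x i) := by
  unfold andFn
  split_ifs with h
  · symm
    apply Finset.prod_eq_one
    intro i _
    rcases hs : S i with _ | b
    · simp [hF]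
    · simp [hF, h i b hs]
  · push Not at h
    obtain ⟨i, b, hs, hx⟩ := h
    symm
    apply Finset.prod_eq_zero (Finset.mem_univ i)
    simp [hF, hs, hx]

theorem sum_prod_coord {d : ℕ} (f : Fin d → Bool → ℝ) :
    ∑ x : Fin d → Bool, ∏ i, f i (x i) = ∏ i, (f i true + f i false) := by
  have := (Finset.prod_univ_sum (fun _ : Fin d => (Finset.univ : Finset Bool)) f).symm
  rw [Fintype.piFinset_univ] at this
  rw [this]
  exact Finset.prod_congr rfl fun i _ => Fintype.sum_bool _

theorem diag_prod {d k : ℕ} (S : Clause d) (hk : clauseCard S = k) :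
    ∏ i, (if S i ≠ none then (1/2 : ℝ) else 2) = (2 : ℝ) ^ ((d : ℤ) - 2 * (k : ℤ)) := by
  rw [Finset.prod_ite, Finset.prod_const, Finset.prod_const]
  have h1 : (Finset.univ.filter fun i => S i ≠ none).card = k := hk
  have h2 := Finset.card_filter_add_card_filter_not (s := (Finset.univ : Finset (Fin d)))
    (fun i => S i ≠ none)
  rw [Finset.card_univ, Fintype.card_fin, h1] at h2
  rw [h1]
  generalize (Finset.univ.filter fun i => ¬ S i ≠ none).card = r at h2 ⊢
  replace h2 : d = k + r := h2.symm
  rw [h2]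
  have : (((k + r : ℕ) : ℤ) - 2 * (k : ℤ)) = (r : ℤ) - (k : ℤ) := by push_cast; ring
  rw [this, zpow_sub₀ (by norm_num)]
  simp only [zpow_natCast, one_div, inv_pow]
  field_simp

theorem exists_coord {d k : ℕ} (S T : Clause d) (hS : clauseCard S = k) (hT : clauseCard T = k)
    (hne : idxSet S ≠ idxSet T) : ∃ i, S i = none ∧ T i ≠ none := by
  by_contra hcon
  push Not at hcon
  apply hne
  symm
  apply Finset.eq_of_subset_of_card_le
  · intro i hi
    simp only [idxSet, Finset.mem_filter, Finset.mem_univ, true_and] at hi ⊢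
    exact fun h => hi (hcon i h)
  · exact (hS.trans hT.symm).le

/-- the matrix of exactly-represented AND features has lower-bounded singular
values.  Let `c : ι → Clause d` index a collection of nondegenerate `k`-clauses with pairwise
distinct index sets, let `W ∈ ℝ^{ι×m}` and let `Φ ∈ ℝ^{m×2^d}` have columns `φ(x)` for
`x ∈ {±1}^d`.  If `(WΦ)_{a,x} = AND_{c a}(x)` for all `a, x`, then
`W Φ Φᵀ Wᵀ ⪰ 2^{d−2k−2} I`. -/
theorem and_features_singular_values {d m k : ℕ} {ι : Type*} [Fintype ι] [DecidableEq ι]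
    (c : ι → Clause d)
    (hk : ∀ a, clauseCard (c a) = k)
    (hdistinct : Function.Injective fun a => idxSet (c a))
    (W : Matrix ι (Fin m) ℝ) (Φ : Matrix (Fin m) (Fin d → Bool) ℝ)
    (hWΦ : ∀ (a : ι) (x : Fin d → Bool), (W * Φ) a x = andFn (c a) x) :
    (W * Φ * Φᵀ * Wᵀ -
      (2 : ℝ) ^ ((d : ℤ) - 2 * (k : ℤ) - 2) • (1 : Matrix ι ι ℝ)).PosSemidef := by
  set t : ℝ := (2 : ℝ) ^ ((d : ℤ) - 2 * (k : ℤ)) with ht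
  have ht0 : 0 < t := by positivity
  let A : Matrix ι (Fin d → Bool) ℝ := W * Φ
  let B : Matrix ι (Fin d → Bool) ℝ := fun a x => ∏ i, gF (c a i) (x i)
  have hA : ∀ a x, A a x = ∏ i, hF (c a i) (x i) := fun a x =>
    (hWΦ a x).trans (andFn_eq_prod _ _)
  have key : ∀ F : Option Bool → Bool → ℝ,
      (∀ s, F none true * gF s true + F none false * gF s false = if s = none then 2 else 0) →
      (∀ s, s ≠ none → F s true * gF s true + F s false * gF s false = 1/2) →
      ∀ a b, ∑ x : Fin d → Bool, (∏ i, F (c a i) (x i)) * (∏ i, gF (c b i) (x i))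
        = (t • (1 : Matrix ι ι ℝ)) a b := by
    intro F h1 h2 a b
    simp only [← Finset.prod_mul_distrib]
    rw [sum_prod_coord (fun i y => F (c a i) y * gF (c b i) y)]
    by_cases hab : a = b
    · subst hab
      simp only [Matrix.smul_apply, Matrix.one_apply_eq, smul_eq_mul, mul_one]
      rw [ht, ← diag_prod (c a) (hk a)]
      apply Finset.prod_congr rfl
      intro i _
      by_cases hi : c a i = none
      · simp [hi, h1]
      · simpa [hi] using h2 _ hi
    · obtain ⟨i, hi, hj⟩ := exists_coord (c a) (c b) (hk a) (hk b) (fun h => hab (hdistinct h))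
      rw [Finset.prod_eq_zero (Finset.mem_univ i)]
      · simp [hab]
      · rw [hi, h1, if_neg hj]
  have hBB : B * Bᵀ = t • (1 : Matrix ι ι ℝ) := by
    ext a b
    refine key gF ?_ ?_ a b
    · rintro (_ | _ | _) <;> norm_num [gF] <;> exact Option.some_ne_none _
    · rintro (_ | _ | _) h <;> first | exact absurd rfl h | norm_num [gF]
  have hAB : A * Bᵀ = t • (1 : Matrix ι ι ℝ) := by
    ext a b
    rw [← key hF ?_ ?_ a b]
    · simp only [Matrix.mul_apply, hA]
      rfl
    · rintro (_ | _ | _) <;> norm_num [gF, hF] <;> exact Option.some_ne_none _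
    · rintro (_ | _ | _) h <;> first | exact absurd rfl h | norm_num [gF, hF]
  have hBA : B * Aᵀ = t • (1 : Matrix ι ι ℝ) := by
    have := congrArg Matrix.transpose hAB
    simpa [Matrix.transpose_mul] using this
  have hps : ((A - B) * (A - B)ᵀ).PosSemidef := by
    simpa [Matrix.conjTranspose_eq_transpose_of_trivial] using
      Matrix.posSemidef_self_mul_conjTranspose (A - B)
  have h4 : (2 : ℝ) ^ ((d : ℤ) - 2 * (k : ℤ) - 2) = t / 4 := by
    rw [zpow_sub₀ (by norm_num), ← ht]; norm_num
  have hI : ((3 * t / 4) • (1 : Matrix ι ι ℝ)).PosSemidef :=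
    Matrix.PosSemidef.one.smul (by positivity)
  have := hps.add hI
  convert this using 1
  rw [h4, Matrix.transpose_sub, Matrix.sub_mul, Matrix.mul_sub, Matrix.mul_sub, hBB, hAB, hBA]
  have hW : W * Φ * Φᵀ * Wᵀ = A * Aᵀ := by
    simp only [A, Matrix.transpose_mul, Matrix.mul_assoc]
  rw [hW, show (3 * t / 4) = t - t / 4 by ring, sub_smul]
  abel
end

section
/- Determinant upper bound from bounded coefficient norms: let W ∈ ℝ^{N×m} with m ≥ N be a matrix each of whose rows has Euclidean norm at most τ, and let Φ ∈ ℝ^{m×2^d} be the matrix whose column indexed by x ∈ {+1,−1}^d is φ(x) for some map φ : {+1,−1}^d → ℝ^m, and set β² = 2^{−d} Σ_{x∈{+1,−1}^d} ‖φ(x)‖². Then det( W Φ Φᵀ Wᵀ ) ≤ ( 2^d β² τ² / N )^N. -/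
open Matrix

lemma amgm_aux {N : ℕ} (z : Fin N → ℝ) (hz : ∀ i, 0 ≤ z i) :
    ∏ i, z i ≤ ((∑ i, z i) / N) ^ N := by
  rcases Nat.eq_zero_or_pos N with h0 | hN
  · subst h0; simp
  have hN' : (0 : ℝ) < N := by exact_mod_cast hN
  have h := Real.geom_mean_le_arith_mean Finset.univ (fun _ : Fin N => (1 : ℝ)) z
    (fun _ _ => zero_le_one) (by simpa using hN) (fun i _ => hz i)
  simp only [Real.rpow_one, one_mul, Finset.sum_const, Finset.card_univ, Fintype.card_fin,
    nsmul_eq_mul, mul_one] at h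
  have hp : 0 ≤ ∏ i, z i := Finset.prod_nonneg (fun i _ => hz i)
  calc ∏ i, z i = ((∏ i, z i) ^ ((N : ℝ)⁻¹)) ^ N := by
        rw [Real.rpow_inv_natCast_pow hp hN.ne']
    _ ≤ _ := pow_le_pow_left₀ (Real.rpow_nonneg hp _) h N

lemma det_le_trace_aux {N : ℕ} {M : Matrix (Fin N) (Fin N) ℝ} (hM : M.PosSemidef) :
    M.det ≤ (M.trace / N) ^ N := by
  rw [hM.1.det_eq_prod_eigenvalues, hM.1.trace_eq_sum_eigenvalues]
  exact amgm_aux _ (fun i => hM.eigenvalues_nonneg i)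

/-- LQ decomposition, with a full orthonormal basis. -/
lemma lq_aux {N m : ℕ} (hNm : N ≤ m) (W : Matrix (Fin N) (Fin m) ℝ) :
    ∃ b : OrthonormalBasis (Fin m) ℝ (EuclideanSpace ℝ (Fin m)),
      ∀ (a : Fin N) (k : Fin m), (a : ℕ) < k → inner ℝ (b k) (WithLp.toLp 2 (W a)) = 0 := by
  let f : Fin m → EuclideanSpace ℝ (Fin m) := fun i =>
    if h : (i : ℕ) < N then WithLp.toLp 2 (W ⟨i, h⟩) else 0
  refine ⟨InnerProductSpace.gramSchmidtOrthonormalBasis (by simp) f, fun a k hk => ?_⟩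
  have := InnerProductSpace.gramSchmidtOrthonormalBasis_inv_triangular (𝕜 := ℝ)
    (by simp : Module.finrank ℝ (EuclideanSpace ℝ (Fin m)) = Fintype.card (Fin m)) f
    (i := Fin.castLE hNm a) (j := k) hk
  simpa [f] using this

theorem det_upper_bound_from_row_norms {N m d : ℕ} (hNm : N ≤ m) (τ : ℝ)
    (W : Matrix (Fin N) (Fin m) ℝ)
    (hrows : ∀ a : Fin N, Real.sqrt (∑ j, W a j ^ 2) ≤ τ)
    (Φ : Matrix (Fin m) (Fin d → Bool) ℝ) :
    (W * Φ * Φᵀ * Wᵀ).det ≤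
      ((2 : ℝ) ^ d * ((∑ x : Fin d → Bool, ∑ j, Φ j x ^ 2) / 2 ^ d) * τ ^ 2 / N) ^ N := by
  obtain ⟨b, hb⟩ := lq_aux hNm W
  let L : Matrix (Fin N) (Fin N) ℝ := Matrix.of fun a i =>
    inner ℝ (b (Fin.castLE hNm i)) (WithLp.toLp 2 (W a))
  let Q : Matrix (Fin N) (Fin m) ℝ := Matrix.of fun i j => b (Fin.castLE hNm i) j
  have hW : W = L * Q := by
    ext a j
    have h1 := b.sum_repr' (WithLp.toLp 2 (W a))
    have h2 := congrArg (fun v : EuclideanSpace ℝ (Fin m) => v j) h1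
    simp only [WithLp.ofLp_sum, WithLp.ofLp_smul, Finset.sum_apply, Pi.smul_apply,
      smul_eq_mul] at h2
    rw [← h2, Matrix.mul_apply]
    symm
    simp only [L, Q, Matrix.of_apply]
    have hinj : Function.Injective (Fin.castLE hNm) := Fin.castLE_injective hNm
    rw [← Finset.sum_image (s := Finset.univ) (g := Fin.castLE hNm)
      (f := fun k => inner ℝ (b k) (WithLp.toLp 2 (W a)) * b k j) (fun x _ y _ h => hinj h)]
    apply Finset.sum_subset (Finset.subset_univ _)
    intro k _ hk
    rw [hb a k, zero_mul]
    by_contra hlt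
    exact hk (Finset.mem_image.2 ⟨⟨k, by omega⟩, Finset.mem_univ _, by ext; simp⟩)
  have hdetL : L.det ^ 2 ≤ (τ ^ 2) ^ N := by
    have ht : L.det = ∏ i, L i i := by
      apply Matrix.det_of_isLowerTriangular
      intro i j hij
      exact hb i (Fin.castLE hNm j) (by simpa using hij)
    rw [ht, ← Finset.prod_pow]
    calc ∏ i, L i i ^ 2 ≤ ∏ _i : Fin N, τ ^ 2 := by
          apply Finset.prod_le_prod (fun i _ => sq_nonneg _)
          intro i _
          have h1 : |L i i| ≤ τ := by
            refine le_trans ?_ (hrows i)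
            simp only [L, Matrix.of_apply]
            refine (abs_real_inner_le_norm _ _).trans ?_
            rw [b.norm_eq_one, one_mul, EuclideanSpace.norm_eq]
            simp
          exact sq_le_sq' (abs_le.1 h1).1 (abs_le.1 h1).2
      _ = _ := by simp
  set S : ℝ := ∑ x : Fin d → Bool, ∑ j, Φ j x ^ 2 with hS
  let M := (Q * Φ) * (Q * Φ)ᵀ
  have hM : M.PosSemidef := by
    simpa [M] using Matrix.posSemidef_self_mul_conjTranspose (Q * Φ)
  have htr : M.trace ≤ S := by
    have : M.trace = ∑ x, ∑ i, (Q * Φ) i x ^ 2 := by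
      rw [Finset.sum_comm]
      simp only [M, Matrix.trace, Matrix.diag, Matrix.mul_apply (M := Q * Φ),
        Matrix.transpose_apply, sq]
    rw [this]
    apply Finset.sum_le_sum
    intro x _
    let v : EuclideanSpace ℝ (Fin m) := WithLp.toLp 2 (fun j => Φ j x)
    have h1 : ∑ k, inner ℝ (b k) v ^ 2 = ∑ j, Φ j x ^ 2 := by
      rw [b.sum_sq_inner_right, EuclideanSpace.real_norm_sq_eq]
    have h2 : ∀ i, (Q * Φ) i x = inner ℝ (b (Fin.castLE hNm i)) v := by
      intro i
      simp [Matrix.mul_apply, Q, v, PiLp.inner_apply, mul_comm]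
    rw [← h1]
    simp only [h2]
    rw [← Finset.sum_image (s := Finset.univ) (g := Fin.castLE hNm)
      (f := fun k => inner ℝ (b k) v ^ 2) (fun x _ y _ h => Fin.castLE_injective hNm h)]
    exact Finset.sum_le_sum_of_subset_of_nonneg (Finset.subset_univ _)
      (fun _ _ _ => sq_nonneg _)
  have hdetM : M.det ≤ (S / N) ^ N := by
    refine (det_le_trace_aux hM).trans ?_
    have := hM.trace_nonneg
    gcongr
  have hfac : (W * Φ * Φᵀ * Wᵀ).det = L.det ^ 2 * M.det := by
    have : W * Φ * Φᵀ * Wᵀ = L * M * Lᵀ := by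
      rw [hW]; simp only [M, Matrix.transpose_mul, Matrix.mul_assoc]
    rw [this, Matrix.det_mul, Matrix.det_mul, Matrix.det_transpose]; ring
  rw [hfac]
  calc L.det ^ 2 * M.det ≤ (τ ^ 2) ^ N * (S / N) ^ N :=
        mul_le_mul hdetL hdetM hM.det_nonneg (by positivity)
    _ = _ := by
      rw [← mul_pow]; congr 1
      field_simp
end
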